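/- arXiv:2305.20043 — 6 statements merged into one kernel-verified Lean document; each statement's English description precedes it below -/
import Mathlib

section
/- Under generalized rejection sampling, for every nonzero mask r the mask marginal satisfies p_R(r) = π_r / Λ_r*. -/
open Finset

noncomputable section

namespace AM

/-- A mask: `r i = true` means coordinate `i` is observed. -/
abbrev Mask (d : ℕ) := Fin d → Bool

/-- The all-missing mask. -/
def zeroMask (d : ℕ) : Mask d := fun _ => false

variable {d : ℕ} {α : Fin d → Type*} [∀ i, Fintype (α i)] [∀ i, DecidableEq (α i)]
  [∀ i, Nonempty (α i)]

/-- Restriction of a sample to the observed coordinates of a mask. -/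
def restr (r : Mask d) (x : ∀ i, α i) : ∀ i : {i : Fin d // r i = true}, α i.1 :=
  fun i => x i.1

/-- Observed marginal of a pmf under mask `r`. -/
def obsMarg (p : (∀ i, α i) → ℝ) (r : Mask d)
    (xo : ∀ i : {i : Fin d // r i = true}, α i.1) : ℝ :=
  ∑ x : ∀ i, α i, if restr r x = xo then p x else 0

/-- Marginal pmf of the mask under missingness mechanism `q`. -/
def maskMarg (p : (∀ i, α i) → ℝ) (q : Mask d → (∀ i, α i) → ℝ) (r : Mask d) : ℝ :=
  ∑ x : ∀ i, α i, p x * q r x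

/-- Conditional pmf of the observed part given the mask: `P(X_o = x_o | R = r)`. -/
def condObs (p : (∀ i, α i) → ℝ) (q : Mask d → (∀ i, α i) → ℝ) (r : Mask d)
    (xo : ∀ i : {i : Fin d // r i = true}, α i.1) : ℝ :=
  (∑ x : ∀ i, α i, if restr r x = xo then p x * q r x else 0) / maskMarg p q r

/-- The number of missing coordinates of a mask. -/
def missCount {d : ℕ} (r : Mask d) : ℕ := (univ.filter fun i => r i = false).card

/-- Total mass of the nonzero masks. -/
def totMass (p : (∀ i, α i) → ℝ) (q : Mask d → (∀ i, α i) → ℝ) : ℝ :=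
  ∑ r' ∈ univ.filter (fun r' : Mask d => r' ≠ zeroMask d), maskMarg p q r'

/-- The modeler's objective. -/
def Jobj (p : (∀ i, α i) → ℝ) (q : Mask d → (∀ i, α i) → ℝ) (θ : (∀ i, α i) → ℝ) : ℝ :=
  ∑ r : Mask d,
    if r ≠ zeroMask d ∧ 0 < maskMarg p q r then
      maskMarg p q r / totMass p q *
        ∑ xo : ∀ i : {i : Fin d // r i = true}, α i.1,
          condObs p q r xo * Real.log (obsMarg θ r xo)
    else 0

/-- Likelihood ratio of adversarial to true observed marginals. -/
def Lam (p pα : (∀ i, α i) → ℝ) (r : Mask d)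
    (xo : ∀ i : {i : Fin d // r i = true}, α i.1) : ℝ :=
  obsMarg pα r xo / obsMarg p r xo

/-- Maximum of the likelihood ratio over observed parts. -/
def LamMax (p pα : (∀ i, α i) → ℝ) (r : Mask d) : ℝ :=
  Finset.univ.sup' Finset.univ_nonempty (Lam p pα r)

/-- Generalized rejection sampling missingness mechanism with weights `w`. -/
def grs (p pα : (∀ i, α i) → ℝ) (w : Mask d → ℝ) (r : Mask d) (x : ∀ i, α i) : ℝ :=
  if r = zeroMask d then
    1 - ∑ r' ∈ univ.filter (fun r' : Mask d => r' ≠ zeroMask d),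
          w r' * Lam p pα r' (restr r' x) / LamMax p pα r'
  else w r * Lam p pα r (restr r x) / LamMax p pα r

/-- Restriction of a sample to the coordinates in a finset. -/
def restrS (S : Finset (Fin d)) (x : ∀ i, α i) : ∀ i : {i : Fin d // i ∈ S}, α i.1 :=
  fun i => x i.1

/-- Marginal pmf of the coordinates in `S`. -/
def margS (p : (∀ i, α i) → ℝ) (S : Finset (Fin d))
    (xs : ∀ i : {i : Fin d // i ∈ S}, α i.1) : ℝ :=
  ∑ x : ∀ i, α i, if restrS S x = xs then p x else 0

/-- Ratio of adversarial to true marginals on `V`. -/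
def LamV (p pα : (∀ i, α i) → ℝ) (V : Finset (Fin d))
    (xv : ∀ i : {i : Fin d // i ∈ V}, α i.1) : ℝ :=
  margS pα V xv / margS p V xv

/-- Maximum of the ratio over configurations of `V`. -/
def LamVMax (p pα : (∀ i, α i) → ℝ) (V : Finset (Fin d)) : ℝ :=
  Finset.univ.sup' Finset.univ_nonempty (LamV p pα V)

/-- Localized rejection sampling missingness mechanism on `V`. -/
def lrs (p pα : (∀ i, α i) → ℝ) (V : Finset (Fin d)) (r : Mask d) (x : ∀ i, α i) : ℝ :=
  if ∀ i ∉ V, r i = true then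
    if ∃ i ∈ V, r i = true then
      1 / ((2 : ℝ) ^ V.card - 1) * (LamV p pα V (restrS V x) / LamVMax p pα V)
    else 1 - LamV p pα V (restrS V x) / LamVMax p pα V
  else 0

/-- Conditional pmf of the complement coordinates given the `V` coordinates. -/
def condComp (p : (∀ i, α i) → ℝ) (V : Finset (Fin d))
    (xv : ∀ i : {i : Fin d // i ∈ V}, α i.1)
    (xc : ∀ i : {i : Fin d // i ∈ Vᶜ}, α i.1) : ℝ :=
  (∑ x : ∀ i, α i, if restrS V x = xv ∧ restrS Vᶜ x = xc then p x else 0) / margS p V xv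

/-- Conditional pmf of the `V` coordinates given the mask: `P(X_V = x_V | R = r)`. -/
def condV (p : (∀ i, α i) → ℝ) (q : Mask d → (∀ i, α i) → ℝ) (V : Finset (Fin d)) (r : Mask d)
    (xv : ∀ i : {i : Fin d // i ∈ V}, α i.1) : ℝ :=
  (∑ x : ∀ i, α i, if restrS V x = xv then p x * q r x else 0) / maskMarg p q r

/-- Conditional pmf of coordinate `j` given that the coordinates in `S` equal `z`. -/
def condAt (p : (∀ i, α i) → ℝ) (S : Finset (Fin d)) (j : Fin d)
    (z : ∀ i : {i : Fin d // i ∈ S}, α i.1) (a : α j) : ℝ :=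
  (∑ x : ∀ i, α i, if restrS S x = z ∧ x j = a then p x else 0) / margS p S z

/-- `p` factorizes according to the parent structure `pa`. -/
def Factorizes (p : (∀ i, α i) → ℝ) (pa : Fin d → Finset (Fin d)) : Prop :=
  ∀ x, p x = ∏ j, condAt p (pa j) j (restrS (pa j) x) (x j)

/-- KL divergence between two pmfs on a finite type. -/
def KL {β : Type*} [Fintype β] (p q : β → ℝ) : ℝ :=
  ∑ b, p b * Real.log (p b / q b)


theorem restr_surjective (r : Mask d) :
    Function.Surjective (restr r : (∀ i, α i) → ∀ i : {i : Fin d // r i = true}, α i.1) := by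
  intro xo
  refine ⟨fun i => if h : r i = true then xo ⟨i, h⟩ else Classical.arbitrary _, ?_⟩
  funext i
  simp [restr, i.2]

theorem obsMarg_pos {p : (∀ i, α i) → ℝ} (hp : ∀ x, 0 < p x) (r : Mask d)
    (xo : ∀ i : {i : Fin d // r i = true}, α i.1) : 0 < obsMarg p r xo := by
  obtain ⟨x, hx⟩ := restr_surjective r xo
  refine sum_pos' (fun y _ => ?_) ⟨x, mem_univ x, by simpa [hx] using hp x⟩
  split_ifs
  exacts [(hp y).le, le_rfl]

/-- The expectation of a function of the observed part is computed from the observed marginal. -/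
theorem sum_mul_restr (p : (∀ i, α i) → ℝ) (r : Mask d)
    (f : (∀ i : {i : Fin d // r i = true}, α i.1) → ℝ) :
    ∑ x, p x * f (restr r x) = ∑ xo, obsMarg p r xo * f xo := by
  simp only [obsMarg, sum_mul]
  rw [sum_comm]
  simp [ite_mul]

theorem sum_obsMarg (p : (∀ i, α i) → ℝ) (r : Mask d) :
    ∑ xo, obsMarg p r xo = ∑ x, p x := by
  simpa using (sum_mul_restr p r fun _ => 1).symm

/-- The likelihood ratio has expectation equal to the total adversarial mass. -/
theorem sum_mul_Lam {p : (∀ i, α i) → ℝ} (hp : ∀ x, 0 < p x) (pα : (∀ i, α i) → ℝ)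
    (r : Mask d) : ∑ x, p x * Lam p pα r (restr r x) = ∑ x, pα x := by
  rw [sum_mul_restr, ← sum_obsMarg pα r]
  exact sum_congr rfl fun xo _ => mul_div_cancel₀ _ (obsMarg_pos hp r xo).ne'

/-- under generalized rejection sampling, for every nonzero mask `r`
the mask marginal satisfies `p_R(r) = π_r / Λ_r*`. -/
theorem stmt0
    {d : ℕ} (hd : 1 ≤ d) {α : Fin d → Type*} [∀ i, Fintype (α i)] [∀ i, DecidableEq (α i)]
    [∀ i, Nonempty (α i)]
    (p pα : (∀ i, α i) → ℝ)
    (hp_pos : ∀ x, 0 < p x) (hp_sum : ∑ x, p x = 1)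
    (hpα_nonneg : ∀ x, 0 ≤ pα x) (hpα_sum : ∑ x, pα x = 1)
    (w : Mask d → ℝ)
    (hw : ∀ r : Mask d, r ≠ zeroMask d → 0 ≤ w r ∧ w r ≤ 1)
    (hvalid : ∀ x : ∀ i, α i,
      ∑ r ∈ univ.filter (fun r : Mask d => r ≠ zeroMask d),
          w r * Lam p pα r (restr r x) / LamMax p pα r ≤ 1)
    (r : Mask d) (hr : r ≠ zeroMask d) :
    maskMarg p (grs p pα w) r = w r / LamMax p pα r := by
  have hterm : ∀ x, p x * grs p pα w r x =
      w r / LamMax p pα r * (p x * Lam p pα r (restr r x)) := fun x => by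
    rw [grs, if_neg hr]
    ring
  simp only [maskMarg, hterm]
  rw [← mul_sum, sum_mul_Lam hp_pos, hpα_sum, mul_one]

end AM
end
end

section
/- Under the localized rejection sampling missingness mechanism on V, the mask marginal satisfies: p_R(r) = 1/((2^{|V|} − 1)·Λ) for every mask r that is true on all of V̄ and not identically false on V, and p_R(r) = 1 − 1/Λ for the mask r that is true on all of V̄ and false on all of V. -/
open Finset

noncomputable section

namespace AM

variable {d : ℕ} {α : Fin d → Type*} [∀ i, Fintype (α i)] [∀ i, DecidableEq (α i)]
  [∀ i, Nonempty (α i)]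

/-- The expectation of a function of `x_S` is computed from the marginal on `S`. -/
theorem sum_mul_comp_restrS {d : ℕ} {α : Fin d → Type*} [∀ i, Fintype (α i)]
    [∀ i, DecidableEq (α i)] (p : (∀ i, α i) → ℝ) (S : Finset (Fin d))
    (f : (∀ i : {i : Fin d // i ∈ S}, α i.1) → ℝ) :
    ∑ x, p x * f (restrS S x) = ∑ xs, margS p S xs * f xs := by
  simp only [margS, Finset.sum_mul]
  rw [Finset.sum_comm]
  simp [ite_mul]

theorem sum_margS {d : ℕ} {α : Fin d → Type*} [∀ i, Fintype (α i)]
    [∀ i, DecidableEq (α i)] (p : (∀ i, α i) → ℝ) (S : Finset (Fin d)) :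
    ∑ xs, margS p S xs = ∑ x, p x := by
  simpa using (sum_mul_comp_restrS p S fun _ => 1).symm

theorem margS_pos {d : ℕ} {α : Fin d → Type*} [∀ i, Fintype (α i)]
    [∀ i, DecidableEq (α i)] [∀ i, Nonempty (α i)] {p : (∀ i, α i) → ℝ} (hp : ∀ x, 0 < p x)
    (S : Finset (Fin d)) (xs : ∀ i : {i : Fin d // i ∈ S}, α i.1) : 0 < margS p S xs := by
  refine Finset.sum_pos' (fun x _ => ?_)
    ⟨fun i => if h : i ∈ S then xs ⟨i, h⟩ else Classical.arbitrary _, Finset.mem_univ _, ?_⟩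
  · split_ifs
    exacts [(hp x).le, le_rfl]
  · rw [if_pos]
    · exact hp _
    · funext i
      simp [restrS]

/-- The likelihood ratio on `V` has mean equal to the total mass of the adversarial pmf. -/
theorem sum_mul_LamV {d : ℕ} {α : Fin d → Type*} [∀ i, Fintype (α i)]
    [∀ i, DecidableEq (α i)] [∀ i, Nonempty (α i)] {p : (∀ i, α i) → ℝ} (hp : ∀ x, 0 < p x)
    (pα : (∀ i, α i) → ℝ) (V : Finset (Fin d)) :
    ∑ x, p x * LamV p pα V (restrS V x) = ∑ x, pα x := by
  rw [sum_mul_comp_restrS, ← sum_margS pα V]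
  exact Finset.sum_congr rfl fun xv _ => mul_div_cancel₀ _ (margS_pos hp V xv).ne'

/-- under localized rejection sampling on `V`, the mask marginal equals
`1/((2^{|V|} − 1)·Λ)` on every mask that observes all of `V̄` and part of `V`, and equals
`1 − 1/Λ` on the mask observing all of `V̄` and none of `V`. -/
theorem stmt7
    {d : ℕ} (hd : 1 ≤ d) {α : Fin d → Type*} [∀ i, Fintype (α i)] [∀ i, DecidableEq (α i)]
    [∀ i, Nonempty (α i)]
    (p pα : (∀ i, α i) → ℝ)
    (hp_pos : ∀ x, 0 < p x) (hp_sum : ∑ x, p x = 1)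
    (hpα_nonneg : ∀ x, 0 ≤ pα x) (hpα_sum : ∑ x, pα x = 1)
    (V : Finset (Fin d)) (hV : V.Nonempty) :
    (∀ r : Mask d, (∀ i ∉ V, r i = true) → (∃ i ∈ V, r i = true) →
        maskMarg p (lrs p pα V) r = 1 / (((2 : ℝ) ^ V.card - 1) * LamVMax p pα V)) ∧
    (∀ r : Mask d, (∀ i ∉ V, r i = true) → (∀ i ∈ V, r i = false) →
        maskMarg p (lrs p pα V) r = 1 - 1 / LamVMax p pα V) := by
  have hmean : ∑ x, p x * (LamV p pα V (restrS V x) / LamVMax p pα V) = 1 / LamVMax p pα V := by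
    simp only [← mul_div_assoc]
    rw [← Finset.sum_div, sum_mul_LamV hp_pos, hpα_sum]
  refine ⟨fun r hr hrV => ?_, fun r hr hrV => ?_⟩
  · simp only [maskMarg, lrs, if_pos hr, if_pos hrV, mul_left_comm (p _)]
    rw [← Finset.mul_sum, hmean, one_div_mul_one_div]
  · have hrV' : ¬∃ i ∈ V, r i = true := by simpa using hrV
    simp only [maskMarg, lrs, if_pos hr, if_neg hrV', mul_sub, mul_one]
    rw [Finset.sum_sub_distrib, hp_sum, hmean]

end AM
end
end

section
/- (KL factorization along a DAG) If p₁ and p₂ are strictly positive pmfs on X that both factorize according to the same parent structure pa, then KL(p₁ ‖ p₂) = Σ over j : Fin d of Σ over configurations z of the coordinates in pa j of (p₁-marginal of x_{pa j} at z)·KL(p₁(· | x_{pa j} = z) ‖ p₂(· | x_{pa j} = z)), where the inner KL is between the conditional pmfs of coordinate j given that its parents equal z. -/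
open Finset

noncomputable section

namespace AM

variable {d : ℕ} {α : Fin d → Type*} [∀ i, Fintype (α i)] [∀ i, DecidableEq (α i)]
  [∀ i, Nonempty (α i)]

/-- The marginal times the conditional pmf is the joint mass of `x_S = z` and `x_j = a`. -/
theorem margS_mul_condAt {d : ℕ} {α : Fin d → Type*} [∀ i, Fintype (α i)]
    [∀ i, DecidableEq (α i)] {p : (∀ i, α i) → ℝ} (hp : ∀ x, 0 ≤ p x) (S : Finset (Fin d))
    (j : Fin d) (z : ∀ i : {i : Fin d // i ∈ S}, α i.1) (a : α j) :
    margS p S z * condAt p S j z a =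
      ∑ x : ∀ i, α i, if restrS S x = z ∧ x j = a then p x else 0 := by
  refine mul_div_cancel_of_imp' fun hz => ?_
  have hzero := (sum_eq_zero_iff_of_nonneg fun x _ => by
    split_ifs
    exacts [hp x, le_rfl]).mp hz
  refine sum_eq_zero fun x hx => ?_
  split_ifs with h
  · simpa [h.1] using hzero x hx
  · rfl

/-- Averaging over `x_S` and then over the conditional law of `x_j` gives the joint expectation. -/
theorem sum_margS_mul_sum_condAt {d : ℕ} {α : Fin d → Type*} [∀ i, Fintype (α i)]
    [∀ i, DecidableEq (α i)] {p : (∀ i, α i) → ℝ} (hp : ∀ x, 0 ≤ p x) (S : Finset (Fin d))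
    (j : Fin d) (f : (∀ i : {i : Fin d // i ∈ S}, α i.1) → α j → ℝ) :
    ∑ z, margS p S z * ∑ a, condAt p S j z a * f z a = ∑ x, p x * f (restrS S x) (x j) := by
  simp_rw [mul_sum, ← mul_assoc, margS_mul_condAt hp, sum_mul, ite_mul, zero_mul]
  rw [← Fintype.sum_prod_type', sum_comm]
  refine sum_congr rfl fun x _ => ?_
  rw [Fintype.sum_eq_single (restrS S x, x j)]
  · simp
  · rintro ⟨z, a⟩ h
    refine if_neg ?_
    rintro ⟨rfl, rfl⟩
    exact h rfl

/-- The factors of a strictly positive factorizing pmf do not vanish. -/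
theorem Factorizes.condAt_ne_zero {d : ℕ} {α : Fin d → Type*} [∀ i, Fintype (α i)]
    [∀ i, DecidableEq (α i)] {p : (∀ i, α i) → ℝ} {pa : Fin d → Finset (Fin d)}
    (h : Factorizes p pa) (hp : ∀ x, 0 < p x) (x : ∀ i, α i) (j : Fin d) :
    condAt p (pa j) j (restrS (pa j) x) (x j) ≠ 0 :=
  prod_ne_zero_iff.mp (h x ▸ (hp x).ne') j (mem_univ j)

/-- KL factorization along a DAG: if `p₁` and `p₂` are strictly positive pmfs
factorizing according to the same parent structure `pa`, then the KL divergence decomposes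
as a sum over coordinates of expected conditional KL divergences. -/
theorem stmt12
    {d : ℕ} (hd : 1 ≤ d) {α : Fin d → Type*} [∀ i, Fintype (α i)] [∀ i, DecidableEq (α i)]
    [∀ i, Nonempty (α i)]
    (pa : Fin d → Finset (Fin d)) (hpa : ∀ j, ∀ i ∈ pa j, i < j)
    (p₁ p₂ : (∀ i, α i) → ℝ)
    (h₁pos : ∀ x, 0 < p₁ x) (h₁sum : ∑ x, p₁ x = 1) (h₁fac : Factorizes p₁ pa)
    (h₂pos : ∀ x, 0 < p₂ x) (h₂sum : ∑ x, p₂ x = 1) (h₂fac : Factorizes p₂ pa) :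
    KL p₁ p₂ = ∑ j : Fin d, ∑ z : ∀ i : {i : Fin d // i ∈ pa j}, α i.1,
      margS p₁ (pa j) z * KL (condAt p₁ (pa j) j z) (condAt p₂ (pa j) j z) := by
  simp only [KL]
  simp_rw [fun j => sum_margS_mul_sum_condAt (fun x => (h₁pos x).le) (pa j) j
    fun z a => Real.log (condAt p₁ (pa j) j z a / condAt p₂ (pa j) j z a)]
  rw [sum_comm]
  refine sum_congr rfl fun x _ => ?_
  rw [← mul_sum, ← Real.log_prod fun j _ =>
    div_ne_zero (h₁fac.condAt_ne_zero h₁pos x j) (h₂fac.condAt_ne_zero h₂pos x j),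
    prod_div_distrib, ← h₁fac x, ← h₂fac x]

end AM
end
end

section
/- (Local edge deletion, conditional matching) Fix a coordinate s and parent structures pa_p and pa_α with pa_α j = pa_p j for all j ≠ s and pa_α s ⊆ pa_p s. Let p be a strictly positive pmf factorizing according to pa_p and p_α a strictly positive pmf factorizing according to pa_α, and suppose p(· | x_{pa_p j} = z) = p_α(· | x_{pa_p j} = z) for every j ≠ s and every configuration z. Then, with V = {s} ∪ pa_p s and V̄ its complement, the conditional pmf of x_{V̄} given x_V is the same under p and under p_α: for every x_V and x_{V̄}, p(x_{V̄} | x_V) = p_α(x_{V̄} | x_V). -/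
open Finset

noncomputable section

namespace AM

variable {d : ℕ} {α : Fin d → Type*} [∀ i, Fintype (α i)] [∀ i, DecidableEq (α i)]
  [∀ i, Nonempty (α i)]

/-- A nonvanishing factor that depends only on the `V` coordinates cancels from the conditional
of the complement coordinates given the `V` coordinates. -/
theorem condComp_eq_of_eq_mul (V : Finset (Fin d)) {p c w : (∀ i, α i) → ℝ}
    (hp : ∀ x, p x = c x * w x) (hc : ∀ x y, restrS V x = restrS V y → c x = c y)
    (hc0 : ∀ x, c x ≠ 0)
    (xv : ∀ i : {i : Fin d // i ∈ V}, α i.1) (xc : ∀ i : {i : Fin d // i ∈ Vᶜ}, α i.1) :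
    condComp p V xv xc = condComp w V xv xc := by
  obtain ⟨y, hy⟩ : ∃ y : ∀ i, α i, restrS V y = xv :=
    ⟨fun i => if h : i ∈ V then xv ⟨i, h⟩ else Classical.arbitrary (α i), by
      funext i; simp [restrS]⟩
  have hpy : ∀ x, restrS V x = xv → p x = c y * w x := fun x hx => by
    rw [hp, hc x y (hx.trans hy.symm)]
  have hnum : (∑ x : ∀ i, α i, if restrS V x = xv ∧ restrS Vᶜ x = xc then p x else 0) =
      c y * ∑ x : ∀ i, α i, if restrS V x = xv ∧ restrS Vᶜ x = xc then w x else 0 := by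
    rw [Finset.mul_sum]
    refine Finset.sum_congr rfl fun x _ => ?_
    split_ifs with h
    · exact hpy x h.1
    · simp
  have hmarg : margS p V xv = c y * margS w V xv := by
    unfold margS
    rw [Finset.mul_sum]
    refine Finset.sum_congr rfl fun x _ => ?_
    split_ifs with h
    · exact hpy x h
    · simp
  unfold condComp
  rw [hnum, hmarg, mul_div_mul_left _ _ (hc0 y)]

/-- For a positive pmf factorizing according to `pa`, the factor of coordinate `s` cancels from the
conditional given any `V` containing `s` and its parents. -/
theorem Factorizes.condComp_eq {p : (∀ i, α i) → ℝ} {pa : Fin d → Finset (Fin d)}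
    (hfac : Factorizes p pa) (hpos : ∀ x, 0 < p x) {s : Fin d} {V : Finset (Fin d)}
    (hs : s ∈ V) (hpa : pa s ⊆ V)
    (xv : ∀ i : {i : Fin d // i ∈ V}, α i.1) (xc : ∀ i : {i : Fin d // i ∈ Vᶜ}, α i.1) :
    condComp p V xv xc =
      condComp (fun x => ∏ j ∈ univ.erase s, condAt p (pa j) j (restrS (pa j) x) (x j))
        V xv xc := by
  have hmul : ∀ x, p x = condAt p (pa s) s (restrS (pa s) x) (x s) *
      ∏ j ∈ univ.erase s, condAt p (pa j) j (restrS (pa j) x) (x j) := fun x => by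
    rw [Finset.mul_prod_erase univ (fun j => condAt p (pa j) j (restrS (pa j) x) (x j))
      (mem_univ s)]
    exact hfac x
  refine condComp_eq_of_eq_mul V hmul (fun x y hxy => ?_) (fun x => ?_) xv xc
  · have hV : ∀ i ∈ V, x i = y i := fun i hi => congrFun hxy ⟨i, hi⟩
    have hr : restrS (pa s) x = restrS (pa s) y := funext fun i => hV i (hpa i.2)
    rw [hr, hV s hs]
  · exact left_ne_zero_of_mul (hmul x ▸ (hpos x).ne')

/-- Local edge deletion, conditional matching: if `p_α` differs from `p` only in
the structural equation of coordinate `s` (where its parents are reduced), then with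
`V = {s} ∪ pa_p s` the conditional pmf of the complement coordinates given the `V` coordinates
agrees under `p` and `p_α`. -/
theorem stmt14
    {d : ℕ} (hd : 1 ≤ d) {α : Fin d → Type*} [∀ i, Fintype (α i)] [∀ i, DecidableEq (α i)]
    [∀ i, Nonempty (α i)]
    (s : Fin d) (pap paα : Fin d → Finset (Fin d))
    (hpap : ∀ j, ∀ i ∈ pap j, i < j) (hpaα : ∀ j, ∀ i ∈ paα j, i < j)
    (heq : ∀ j : Fin d, j ≠ s → paα j = pap j) (hsub : paα s ⊆ pap s)
    (p : (∀ i, α i) → ℝ)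
    (hp_pos : ∀ x, 0 < p x) (hp_sum : ∑ x, p x = 1) (hp_fac : Factorizes p pap)
    (pα : (∀ i, α i) → ℝ)
    (hpα_pos : ∀ x, 0 < pα x) (hpα_sum : ∑ x, pα x = 1) (hpα_fac : Factorizes pα paα)
    (hcond : ∀ j : Fin d, j ≠ s →
      ∀ z : ∀ i : {i : Fin d // i ∈ pap j}, α i.1, ∀ a : α j,
        condAt p (pap j) j z a = condAt pα (pap j) j z a) :
    ∀ xv : ∀ i : {i : Fin d // i ∈ insert s (pap s)}, α i.1,
      ∀ xc : ∀ i : {i : Fin d // i ∈ (insert s (pap s))ᶜ}, α i.1,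
        condComp p (insert s (pap s)) xv xc = condComp pα (insert s (pap s)) xv xc := by
  intro xv xc
  rw [hp_fac.condComp_eq hp_pos (mem_insert_self s _) (subset_insert s _),
    hpα_fac.condComp_eq hpα_pos (mem_insert_self s _) (hsub.trans (subset_insert s _))]
  congr 1
  funext x
  refine Finset.prod_congr rfl fun j hj => ?_
  have hjs := ne_of_mem_erase hj
  rw [heq j hjs, hcond j hjs]

end AM
end
end

section
/- (Optimal adversarial SCM for linear Gaussian SCMs) The diagonal matrix D_α has strictly positive diagonal entries, and for every matrix B supported on pa_α and every diagonal matrix D with strictly positive diagonal entries, KL(Σ, Σ(B_α, D_α)) ≤ KL(Σ, Σ(B, D)). That is, among all mean-zero linear Gaussian SCMs Markov with respect to the adversarial DAG, the one given by (B_α, D_α) minimizes the KL divergence from N(0, Σ). -/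
open Matrix

noncomputable section

namespace AM

variable {d : ℕ}

/-- Submatrix of `M` with rows in `S` and columns in `T`. -/
def subM (M : Matrix (Fin d) (Fin d) ℝ) (S T : Finset (Fin d)) :
    Matrix {i : Fin d // i ∈ S} {i : Fin d // i ∈ T} ℝ :=
  fun i j => M i.1 j.1

/-- The column `Σ_{S,{j}}` of a matrix, as a vector indexed by `S`. -/
def colVec (M : Matrix (Fin d) (Fin d) ℝ) (S : Finset (Fin d)) (j : Fin d) :
    {i : Fin d // i ∈ S} → ℝ :=
  fun i => M i.1 j

/-- The optimal adversarial autoregression matrix: its `j`-th column, restricted to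
`pa_α j`, equals `(Σ_{pa_α j, pa_α j})⁻¹ · Σ_{pa_α j, {j}}`, and it vanishes elsewhere. -/
def Balpha (Cov : Matrix (Fin d) (Fin d) ℝ) (paα : Fin d → Finset (Fin d)) :
    Matrix (Fin d) (Fin d) ℝ :=
  fun i j =>
    if h : i ∈ paα j then ((subM Cov (paα j) (paα j))⁻¹ *ᵥ colVec Cov (paα j) j) ⟨i, h⟩
    else 0

/-- The diagonal entries of the optimal adversarial noise matrix:
`(D_α) j j = Σ j j − Σ_{{j}, pa_α j} · (Σ_{pa_α j, pa_α j})⁻¹ · Σ_{pa_α j, {j}}`. -/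
def dAlpha (Cov : Matrix (Fin d) (Fin d) ℝ) (paα : Fin d → Finset (Fin d)) (j : Fin d) : ℝ :=
  Cov j j - colVec Cov (paα j) j ⬝ᵥ ((subM Cov (paα j) (paα j))⁻¹ *ᵥ colVec Cov (paα j) j)

/-- Covariance matrix `(I − B)⁻ᵀ · D · (I − B)⁻¹` of the mean-zero linear Gaussian SCM
`X = BᵀX + n`, `n ∼ N(0, diagonal δ)`. -/
def covOf (B : Matrix (Fin d) (Fin d) ℝ) (δ : Fin d → ℝ) : Matrix (Fin d) (Fin d) ℝ :=
  ((1 - B)ᵀ)⁻¹ * Matrix.diagonal δ * (1 - B)⁻¹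

/-- KL divergence of `N(0, S₁)` from `N(0, S₂)`. -/
def KLg (d : ℕ) (S₁ S₂ : Matrix (Fin d) (Fin d) ℝ) : ℝ :=
  1 / 2 * (Matrix.trace (S₂⁻¹ * S₁) - (d : ℝ) + Real.log (S₂.det / S₁.det))


/-- If `B` is strictly upper triangular, then `I - B` is unitriangular. -/
lemma det_one_sub_of_strictUpper {B : Matrix (Fin d) (Fin d) ℝ}
    (hB : ∀ i j, B i j ≠ 0 → i < j) : (1 - B).det = 1 := by
  have hdiag : ∀ i, B i i = 0 := fun i => by
    by_contra h
    exact lt_irrefl _ (hB i i h)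
  have htri : (1 - B).BlockTriangular id := by
    intro i j hij
    have hij : j < i := hij
    have h0 : B i j = 0 := by
      by_contra h
      exact lt_asymm hij (hB i j h)
    simp [h0, Matrix.one_apply_ne hij.ne']
  rw [Matrix.det_of_isUpperTriangular htri]
  simp [hdiag]

lemma det_covOf {B : Matrix (Fin d) (Fin d) ℝ} (hB : (1 - B).det = 1) (δ : Fin d → ℝ) :
    (covOf B δ).det = ∏ j, δ j := by
  simp [covOf, Matrix.det_nonsing_inv, Matrix.det_transpose, hB, -Matrix.transpose_sub]

lemma inv_covOf {B : Matrix (Fin d) (Fin d) ℝ} (hB : (1 - B).det = 1) {δ : Fin d → ℝ}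
    (hδ : ∀ j, 0 < δ j) :
    (covOf B δ)⁻¹ = (1 - B) * Matrix.diagonal (fun j => (δ j)⁻¹) * (1 - B)ᵀ := by
  have hu : IsUnit (1 - B).det := by simp [hB]
  have hut : IsUnit (1 - B)ᵀ.det := by rw [Matrix.det_transpose]; exact hu
  have hdiag : Matrix.diagonal δ * Matrix.diagonal (fun j => (δ j)⁻¹) = 1 := by
    rw [Matrix.diagonal_mul_diagonal, ← Matrix.diagonal_one]
    congr 1
    funext j
    exact mul_inv_cancel₀ (hδ j).ne'
  apply Matrix.inv_eq_right_inv
  calc covOf B δ * ((1 - B) * Matrix.diagonal (fun j => (δ j)⁻¹) * (1 - B)ᵀ)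
      = ((1 - B)ᵀ)⁻¹ * (Matrix.diagonal δ * (((1 - B)⁻¹ * (1 - B)) *
          Matrix.diagonal (fun j => (δ j)⁻¹))) * (1 - B)ᵀ := by
        simp only [covOf, Matrix.mul_assoc]
    _ = 1 := by
        rw [Matrix.nonsing_inv_mul _ hu, Matrix.one_mul, hdiag, Matrix.mul_one,
          Matrix.nonsing_inv_mul _ hut]

lemma posDef_covOf {B : Matrix (Fin d) (Fin d) ℝ} (hB : (1 - B).det = 1) {δ : Fin d → ℝ}
    (hδ : ∀ j, 0 < δ j) : (covOf B δ).PosDef := by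
  have hu : IsUnit (1 - B) := by simp [Matrix.isUnit_iff_isUnit_det, hB]
  have h := (Matrix.PosDef.diagonal hδ).conjTranspose_mul_mul_same
    (Matrix.mulVec_injective_of_isUnit ((Matrix.isUnit_nonsing_inv_iff).2 hu))
  rwa [Matrix.conjTranspose_eq_transpose_of_trivial, Matrix.transpose_nonsing_inv] at h

/-- The trace term of the KL divergence is the sum of the noise-weighted residual variances. -/
lemma trace_inv_covOf_mul {B : Matrix (Fin d) (Fin d) ℝ} (hB : (1 - B).det = 1)
    {δ : Fin d → ℝ} (hδ : ∀ j, 0 < δ j) (Cov : Matrix (Fin d) (Fin d) ℝ) :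
    ((covOf B δ)⁻¹ * Cov).trace =
      ∑ j, (1 - B).col j ⬝ᵥ (Cov *ᵥ (1 - B).col j) / δ j := by
  rw [inv_covOf hB hδ, Matrix.mul_assoc, Matrix.mul_assoc, Matrix.trace_mul_comm,
    Matrix.mul_assoc, Matrix.trace]
  refine Finset.sum_congr rfl fun j _ => ?_
  rw [Matrix.diag_apply, Matrix.diagonal_mul, Matrix.mul_assoc, div_eq_inv_mul]
  rfl

lemma KLg_covOf {B : Matrix (Fin d) (Fin d) ℝ} (hB : (1 - B).det = 1)
    {δ : Fin d → ℝ} (hδ : ∀ j, 0 < δ j) {Cov : Matrix (Fin d) (Fin d) ℝ} (hCov : Cov.PosDef) :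
    KLg d Cov (covOf B δ) = 1 / 2 *
      (∑ j, ((1 - B).col j ⬝ᵥ (Cov *ᵥ (1 - B).col j) / δ j + Real.log (δ j))
        - d - Real.log Cov.det) := by
  rw [KLg, trace_inv_covOf_mul hB hδ, det_covOf hB,
    Real.log_div (Finset.prod_pos fun j _ => hδ j).ne' hCov.det_pos.ne',
    Real.log_prod fun j _ => (hδ j).ne', Finset.sum_add_distrib]
  ring

lemma Balpha_of_notMem (Cov : Matrix (Fin d) (Fin d) ℝ) {pa : Fin d → Finset (Fin d)}
    {i j : Fin d} (h : i ∉ pa j) : Balpha Cov pa i j = 0 := by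
  simp [Balpha, h]

lemma mulVec_col_Balpha (Cov : Matrix (Fin d) (Fin d) ℝ) (pa : Fin d → Finset (Fin d))
    (i j : Fin d) :
    (Cov *ᵥ (Balpha Cov pa).col j) i = ∑ k : {k // k ∈ pa j},
      Cov i k * ((subM Cov (pa j) (pa j))⁻¹ *ᵥ colVec Cov (pa j) j) k := by
  calc (Cov *ᵥ (Balpha Cov pa).col j) i
      = ∑ k, Cov i k * Balpha Cov pa k j := rfl
    _ = ∑ k ∈ pa j, Cov i k * Balpha Cov pa k j :=
        (Finset.sum_subset (Finset.subset_univ _) fun k _ hk => by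
          simp [Balpha_of_notMem Cov hk]).symm
    _ = ∑ k : {k // k ∈ pa j}, Cov i k * Balpha Cov pa k j :=
        (Finset.sum_coe_sort (pa j) fun k => Cov i k * Balpha Cov pa k j).symm
    _ = _ := by simp [Balpha]

lemma col_one_sub (B : Matrix (Fin d) (Fin d) ℝ) (j : Fin d) :
    (1 - B).col j = Pi.single j 1 - B.col j := by
  ext k
  simp [Matrix.one_apply, Pi.single_apply]

/-- The residual of regressing coordinate `j` on its parents is uncorrelated with each parent. -/
lemma mulVec_col_one_sub_Balpha {Cov : Matrix (Fin d) (Fin d) ℝ} (hCov : Cov.PosDef)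
    (pa : Fin d → Finset (Fin d)) {i j : Fin d} (hi : i ∈ pa j) :
    (Cov *ᵥ (1 - Balpha Cov pa).col j) i = 0 := by
  have hsub : (subM Cov (pa j) (pa j)).PosDef :=
    hCov.submatrix (Subtype.val_injective (p := fun i => i ∈ pa j))
  have hnormal : subM Cov (pa j) (pa j) *ᵥ
      ((subM Cov (pa j) (pa j))⁻¹ *ᵥ colVec Cov (pa j) j) = colVec Cov (pa j) j := by
    rw [Matrix.mulVec_mulVec, Matrix.mul_nonsing_inv _ hsub.det_pos.ne'.isUnit, Matrix.one_mulVec]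
  have hB : (Cov *ᵥ (Balpha Cov pa).col j) i = Cov i j := by
    rw [mulVec_col_Balpha]
    exact congrFun hnormal ⟨i, hi⟩
  rw [col_one_sub, Matrix.mulVec_sub, Pi.sub_apply, hB]
  simp

/-- `dAlpha` is the residual variance of regressing coordinate `j` on its parents. -/
lemma dAlpha_eq {Cov : Matrix (Fin d) (Fin d) ℝ} (hCov : Cov.PosDef)
    (pa : Fin d → Finset (Fin d)) (j : Fin d) :
    dAlpha Cov pa j =
      (1 - Balpha Cov pa).col j ⬝ᵥ (Cov *ᵥ (1 - Balpha Cov pa).col j) := by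
  have horth : (Balpha Cov pa).col j ⬝ᵥ (Cov *ᵥ (1 - Balpha Cov pa).col j) = 0 := by
    refine Finset.sum_eq_zero fun i _ => ?_
    by_cases hi : i ∈ pa j
    · rw [mulVec_col_one_sub_Balpha hCov pa hi, mul_zero]
    · simp [Balpha_of_notMem Cov hi]
  have hrow : (Cov *ᵥ (Balpha Cov pa).col j) j =
      colVec Cov (pa j) j ⬝ᵥ ((subM Cov (pa j) (pa j))⁻¹ *ᵥ colVec Cov (pa j) j) := by
    rw [mulVec_col_Balpha]
    refine Finset.sum_congr rfl fun k _ => ?_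
    have hsymm : Cov j k = Cov k j := by simpa using hCov.isHermitian.apply k j
    simp [colVec, hsymm]
  nth_rewrite 1 [col_one_sub]
  rw [sub_dotProduct, horth, sub_zero, single_one_dotProduct, col_one_sub, Matrix.mulVec_sub,
    Pi.sub_apply, hrow]
  simp [dAlpha]

/-- Least squares: the regression residual has the smallest variance among all
residuals that are linear in the parents. -/
lemma dAlpha_le {Cov : Matrix (Fin d) (Fin d) ℝ} (hCov : Cov.PosDef)
    {pa : Fin d → Finset (Fin d)} {B : Matrix (Fin d) (Fin d) ℝ}
    (hB : ∀ i j, B i j ≠ 0 → i ∈ pa j) (j : Fin d) :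
    dAlpha Cov pa j ≤ (1 - B).col j ⬝ᵥ (Cov *ᵥ (1 - B).col j) := by
  rw [dAlpha_eq hCov]
  set r := (1 - Balpha Cov pa).col j with hr
  set w := (Balpha Cov pa - B).col j with hw
  have hcol : (1 - B).col j = r + w := by
    ext k
    simp [hr, hw]
  have horth : w ⬝ᵥ (Cov *ᵥ r) = 0 := by
    refine Finset.sum_eq_zero fun i _ => ?_
    by_cases hi : i ∈ pa j
    · rw [hr, mulVec_col_one_sub_Balpha hCov pa hi, mul_zero]
    · have hBi : B i j = 0 := by
        by_contra h
        exact hi (hB i j h)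
      simp [hw, Balpha_of_notMem Cov hi, hBi]
  have hsymm : Covᵀ = Cov := by
    simpa [Matrix.conjTranspose_eq_transpose_of_trivial] using hCov.isHermitian.eq
  have horth' : r ⬝ᵥ (Cov *ᵥ w) = 0 := by
    rw [dotProduct_mulVec, ← Matrix.mulVec_transpose, hsymm, dotProduct_comm, horth]
  have hnonneg : 0 ≤ w ⬝ᵥ (Cov *ᵥ w) := by
    simpa using hCov.posSemidef.dotProduct_mulVec_nonneg w
  rw [hcol, Matrix.mulVec_add, dotProduct_add, add_dotProduct, add_dotProduct, horth, horth']
  linarith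

lemma dAlpha_pos {Cov : Matrix (Fin d) (Fin d) ℝ} (hCov : Cov.PosDef)
    {pa : Fin d → Finset (Fin d)} {j : Fin d} (hj : j ∉ pa j) : 0 < dAlpha Cov pa j := by
  rw [dAlpha_eq hCov]
  have hne : (1 - Balpha Cov pa).col j ≠ 0 := fun h => by
    have := congrFun h j
    simp [Balpha_of_notMem Cov hj] at this
  simpa using hCov.dotProduct_mulVec_pos hne

lemma one_add_log_le_div_add_log {a q x : ℝ} (ha : 0 < a) (haq : a ≤ q) (hx : 0 < x) :
    1 + Real.log a ≤ q / x + Real.log x := by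
  have h := Real.log_le_sub_one_of_pos (div_pos ha hx)
  rw [Real.log_div ha.ne' hx.ne'] at h
  have : a / x ≤ q / x := by gcongr
  linarith

/-- Optimal adversarial SCM for linear Gaussian SCMs: `D_α` has strictly
positive diagonal, and among all mean-zero linear Gaussian SCMs Markov with respect to the
adversarial DAG, `(B_α, D_α)` minimizes the KL divergence from `N(0, Σ)`. -/
theorem stmt16
    {d : ℕ} (hd : 1 ≤ d)
    (pap paα : Fin d → Finset (Fin d))
    (hpap : ∀ j, ∀ i ∈ pap j, i < j) (hsub : ∀ j, paα j ⊆ pap j)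
    (Cov : Matrix (Fin d) (Fin d) ℝ)
    (Bp : Matrix (Fin d) (Fin d) ℝ) (δp : Fin d → ℝ)
    (hBp : ∀ i j, Bp i j ≠ 0 → i ∈ pap j) (hδp : ∀ j, 0 < δp j)
    (hCov : Cov = covOf Bp δp) :
    (∀ j, 0 < dAlpha Cov paα j) ∧
    ∀ (B : Matrix (Fin d) (Fin d) ℝ) (δ : Fin d → ℝ),
      (∀ i j, B i j ≠ 0 → i ∈ paα j) → (∀ j, 0 < δ j) →
      KLg d Cov (covOf (Balpha Cov paα) (dAlpha Cov paα)) ≤ KLg d Cov (covOf B δ) := by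
  have hparent : ∀ j, ∀ i ∈ paα j, i < j := fun j i hi => hpap j i (hsub j hi)
  have hPD : Cov.PosDef := hCov ▸
    posDef_covOf (det_one_sub_of_strictUpper fun i j h => hpap j i (hBp i j h)) hδp
  have hpos : ∀ j, 0 < dAlpha Cov paα j := fun j =>
    dAlpha_pos hPD fun hj => lt_irrefl _ (hparent j j hj)
  refine ⟨hpos, fun B δ hB hδ => ?_⟩
  have hdetα : (1 - Balpha Cov paα).det = 1 := det_one_sub_of_strictUpper fun i j h =>
    hparent j i (by
      by_contra hi
      exact h (Balpha_of_notMem Cov hi))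
  have hdet : (1 - B).det = 1 :=
    det_one_sub_of_strictUpper fun i j h => hparent j i (hB i j h)
  rw [KLg_covOf hdetα hpos hPD, KLg_covOf hdet hδ hPD]
  gcongr ?_ * (?_ - _ - _)
  refine Finset.sum_le_sum fun j _ => ?_
  rw [← dAlpha_eq hPD, div_self (hpos j).ne']
  exact one_add_log_le_div_add_log (hpos j) (dAlpha_le hPD hB j) (hδ j)

end AM
end
end

section
/- If the missingness mechanism q satisfies the matching condition — for every nonzero mask r with p_R(r) > 0, P(X_o = x_o | R = r) = p_α^r(x_o) for all observed parts x_o, with p_α strictly positive — then for every strictly positive pmf θ on X the gap of the modeler's objective decomposes as a nonnegative mixture of KL divergences: J(p_α) − J(θ) = Σ over nonzero masks r with p_R(r) > 0 of (p_R(r)/Σ_{r'≠0} p_R(r'))·KL(p_α^r ‖ θ^r), where KL(p_α^r ‖ θ^r) = Σ over observed parts x_o of p_α^r(x_o)·log(p_α^r(x_o)/θ^r(x_o)). -/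
open Finset

noncomputable section

namespace AM

variable {d : ℕ} {α : Fin d → Type*} [∀ i, Fintype (α i)] [∀ i, DecidableEq (α i)]
  [∀ i, Nonempty (α i)]

/-- under the matching condition, the gap of the modeler's objective decomposes
as a nonnegative mixture of KL divergences between observed marginals. -/
theorem stmt17
    {d : ℕ} (hd : 1 ≤ d) {α : Fin d → Type*} [∀ i, Fintype (α i)] [∀ i, DecidableEq (α i)]
    [∀ i, Nonempty (α i)]
    (p : (∀ i, α i) → ℝ) (hp_pos : ∀ x, 0 < p x) (hp_sum : ∑ x, p x = 1)
    (q : Mask d → (∀ i, α i) → ℝ)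
    (hq_nonneg : ∀ r x, 0 ≤ q r x) (hq_sum : ∀ x, ∑ r : Mask d, q r x = 1)
    (hpos : 0 < totMass p q)
    (pα : (∀ i, α i) → ℝ) (hpα_pos : ∀ x, 0 < pα x) (hpα_sum : ∑ x, pα x = 1)
    (hmatch : ∀ r : Mask d, r ≠ zeroMask d → 0 < maskMarg p q r →
      ∀ xo : ∀ i : {i : Fin d // r i = true}, α i.1,
        condObs p q r xo = obsMarg pα r xo)
    (θ : (∀ i, α i) → ℝ) (hθ_pos : ∀ x, 0 < θ x) (hθ_sum : ∑ x, θ x = 1) :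
    Jobj p q pα - Jobj p q θ
      = ∑ r : Mask d,
          if r ≠ zeroMask d ∧ 0 < maskMarg p q r then
            maskMarg p q r / totMass p q *
              ∑ xo : ∀ i : {i : Fin d // r i = true}, α i.1,
                obsMarg pα r xo * Real.log (obsMarg pα r xo / obsMarg θ r xo)
          else 0 := by
  unfold Jobj
  rw [← sum_sub_distrib]
  refine sum_congr rfl fun r _ => ?_
  split_ifs with h
  · rw [← mul_sub, ← sum_sub_distrib]
    congr 1
    refine sum_congr rfl fun xo _ => ?_
    rw [hmatch r h.1 h.2, Real.log_div (obsMarg_pos hpα_pos r xo).ne'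
      (obsMarg_pos hθ_pos r xo).ne', mul_sub]
  · exact sub_zero 0

end AM
end
end
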